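/- For every integer k ≥ 2, q(K_1 ∨ ((k−2)P_2 ∪ S_3 ∪ P_1)) > q(K_1 ∨ (kP_2)). -/

import Mathlib

namespace QPaper

open SimpleGraph

/-- The signless Laplacian matrix `Q(G) = D(G) + A(G)` of a graph, over `ℝ`. -/
noncomputable def signlessLap {V : Type*} [Fintype V] [DecidableEq V] (G : SimpleGraph V) :
    Matrix V V ℝ :=
  letI := Classical.decRel G.Adj
  G.degMatrix ℝ + G.adjMatrix ℝ

/-- The `Q`-index of a graph: the largest eigenvalue of its signless Laplacian matrix. -/
noncomputable def qIndex {V : Type*} [Fintype V] [DecidableEq V] (G : SimpleGraph V) : ℝ :=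
  sSup (spectrum ℝ (signlessLap G))

/-- The number of edges (size) of a graph. -/
noncomputable def numEdges {V : Type*} (G : SimpleGraph V) : ℕ :=
  Nat.card G.edgeSet

/-- The degree of a vertex. -/
noncomputable def deg {V : Type*} (G : SimpleGraph V) (v : V) : ℕ :=
  Nat.card (G.neighborSet v)

/-- A graph is `2` leaves-free if it has at most one vertex of degree one. -/
def TwoLeavesFree {V : Type*} (G : SimpleGraph V) : Prop :=
  ∀ u v : V, deg G u = 1 → deg G v = 1 → u = v

/-- The maximum degree `Δ(G)`. -/
noncomputable def maxDeg {V : Type*} [Fintype V] (G : SimpleGraph V) : ℕ :=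
  letI := Classical.decEq V
  letI := Classical.decRel G.Adj
  G.maxDegree

/-- `k` disjoint copies of `P₂`, i.e. a perfect matching on `2k` vertices. -/
def matching (k : ℕ) : SimpleGraph (Fin k × Fin 2) :=
  SimpleGraph.fromRel (fun a b => a.1 = b.1)

/-- The star graph `Sₙ` on `n` vertices (`K_{1,n-1}` with center `0`). -/
def starGraph (n : ℕ) : SimpleGraph (Fin n) :=
  SimpleGraph.fromRel (fun a _ => (a : ℕ) = 0)

/-- Disjoint union of two graphs. -/
def dUnion {α β : Type*} (G : SimpleGraph α) (H : SimpleGraph β) : SimpleGraph (α ⊕ β) :=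
  SimpleGraph.fromRel (fun a b =>
    (∃ x y, a = Sum.inl x ∧ b = Sum.inl y ∧ G.Adj x y) ∨
    (∃ x y, a = Sum.inr x ∧ b = Sum.inr y ∧ H.Adj x y))

/-- The join `K₁ ∨ H` : a new vertex (`none`) adjacent to every vertex of `H`. -/
def cone {α : Type*} (H : SimpleGraph α) : SimpleGraph (Option α) :=
  SimpleGraph.fromRel (fun a b =>
    a = none ∨ ∃ x y, a = some x ∧ b = some y ∧ H.Adj x y)

open scoped Classical in
theorem signlessLap_mulVec {V : Type*} [Fintype V] [DecidableEq V] (G : SimpleGraph V)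
    (x : V → ℝ) (v : V) :
    (signlessLap G).mulVec x v = ∑ u, if G.Adj v u then x v + x u else 0 := by
  simp only [signlessLap, Matrix.add_mulVec, Pi.add_apply, degMatrix]
  rw [Matrix.mulVec_diagonal, adjMatrix_mulVec_apply, ← Finset.sum_filter, Finset.sum_add_distrib,
    Finset.sum_const, ← G.card_neighborFinset_eq_degree, neighborFinset_eq_filter, nsmul_eq_mul]

theorem signlessLap_nonneg {V : Type*} [Fintype V] [DecidableEq V] (G : SimpleGraph V)
    (u v : V) : 0 ≤ signlessLap G u v := by
  classical
  simp only [signlessLap, Matrix.add_apply, degMatrix, Matrix.diagonal_apply, adjMatrix_apply]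
  positivity

theorem signlessLap_isHermitian {V : Type*} [Fintype V] [DecidableEq V] (G : SimpleGraph V) :
    (signlessLap G).IsHermitian := by
  classical
  ext i j
  simp only [signlessLap, Matrix.conjTranspose_apply, Matrix.add_apply, degMatrix,
    Matrix.diagonal_apply, adjMatrix_apply, star_trivial, G.adj_comm, eq_comm]
  by_cases h : i = j
  · subst h; simp
  · simp [h]

/-- Collatz–Wielandt bound: a positive vector `x` with `A x ≤ q x` bounds the spectrum of a
nonnegative matrix `A`. -/
theorem spectrum_le_of_mulVec_le {V : Type*} [Fintype V] [DecidableEq V] {A : Matrix V V ℝ}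
    (hA : ∀ u v, 0 ≤ A u v) {x : V → ℝ} (hx : ∀ v, 0 < x v) {q : ℝ}
    (h : ∀ v, A.mulVec x v ≤ q * x v) {μ : ℝ} (hμ : μ ∈ spectrum ℝ A) : μ ≤ q := by
  rw [← Matrix.spectrum_toLin', ← Module.End.hasEigenvalue_iff_mem_spectrum] at hμ
  obtain ⟨w, hw⟩ := hμ.exists_hasEigenvector
  have hw0 := hw.2
  have hwe : A.mulVec w = μ • w := by simpa using hw.apply_eq_smul
  obtain ⟨a, ha⟩ := Function.ne_iff.1 hw0
  obtain ⟨i, -, hi⟩ := Finset.exists_max_image Finset.univ (fun v => |w v| / x v)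
    ⟨a, Finset.mem_univ a⟩
  set r := |w i| / x i with hr
  have hr0 : 0 < r := lt_of_lt_of_le (div_pos (abs_pos.2 ha) (hx a)) (hi a (Finset.mem_univ a))
  have hle : ∀ v, |w v| ≤ r * x v := fun v =>
    (div_le_iff₀ (hx v)).1 (hi v (Finset.mem_univ v))
  have heq : |w i| = r * x i := by rw [hr, div_mul_cancel₀ _ (hx i).ne']
  have key : μ * (r * x i) ≤ q * (r * x i) := by
    calc μ * (r * x i) ≤ |μ * w i| := by
          rw [abs_mul, ← heq]; exact mul_le_mul_of_nonneg_right (le_abs_self μ) (abs_nonneg _)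
      _ = |∑ j, A i j * w j| := by
          have := congrFun hwe i
          simp only [Matrix.mulVec, dotProduct, Pi.smul_apply, smul_eq_mul] at this
          rw [this]
      _ ≤ ∑ j, |A i j * w j| := Finset.abs_sum_le_sum_abs _ _
      _ ≤ ∑ j, r * (A i j * x j) := by
          refine Finset.sum_le_sum fun j _ => ?_
          rw [abs_mul, abs_of_nonneg (hA i j), mul_left_comm]
          exact mul_le_mul_of_nonneg_left (hle j) (hA i j)
      _ = r * A.mulVec x i := by rw [← Finset.mul_sum]; rfl
      _ ≤ r * (q * x i) := mul_le_mul_of_nonneg_left (h i) hr0.le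
      _ = q * (r * x i) := by ring
  exact le_of_mul_le_mul_right key (mul_pos hr0 (hx i))

/-- A Hermitian matrix whose spectrum is bounded above by `q` has Rayleigh quotients at most
`q`. -/
theorem dotProduct_mulVec_le {V : Type*} [Fintype V] [DecidableEq V] {A : Matrix V V ℝ}
    (hA : A.IsHermitian) {q : ℝ} (h : ∀ μ ∈ spectrum ℝ A, μ ≤ q) (y : V → ℝ) :
    y ⬝ᵥ A.mulVec y ≤ q * (y ⬝ᵥ y) := by
  have hM : (algebraMap ℝ (Matrix V V ℝ) q - A).IsHermitian := by
    refine Matrix.IsHermitian.sub ?_ hA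
    simp [Matrix.IsHermitian, Matrix.algebraMap_eq_diagonal]
  have hpsd : (algebraMap ℝ (Matrix V V ℝ) q - A).PosSemidef := by
    rw [hM.posSemidef_iff_eigenvalues_nonneg]
    intro i
    have hi := hM.eigenvalues_mem_spectrum_real i
    rw [← spectrum.singleton_sub_eq, Set.singleton_sub] at hi
    obtain ⟨μ, hμ, hi⟩ := hi
    have := h μ hμ
    simp only [Pi.zero_apply]
    linarith
  have := hpsd.dotProduct_mulVec_nonneg y
  rw [Matrix.sub_mulVec, dotProduct_sub, Algebra.algebraMap_eq_smul_one, Matrix.smul_mulVec,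
    Matrix.one_mulVec, dotProduct_smul, star_trivial, smul_eq_mul] at this
  linarith

theorem lt_qIndex {V : Type*} [Fintype V] [DecidableEq V] (G : SimpleGraph V) {q : ℝ}
    (y : V → ℝ) (h : q * (y ⬝ᵥ y) < y ⬝ᵥ (signlessLap G).mulVec y) : q < qIndex G := by
  by_contra! hq
  have hfin : (spectrum ℝ (signlessLap G)).Finite := Matrix.finite_real_spectrum
  exact absurd (dotProduct_mulVec_le (signlessLap_isHermitian G)
    (fun μ hμ => (le_csSup hfin.bddAbove hμ).trans hq) y) (not_le.2 h)

theorem qIndex_le {V : Type*} [Fintype V] [DecidableEq V] (G : SimpleGraph V) {q : ℝ}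
    (hq : 0 ≤ q) {x : V → ℝ} (hx : ∀ v, 0 < x v)
    (h : ∀ v, (signlessLap G).mulVec x v ≤ q * x v) : qIndex G ≤ q :=
  Real.sSup_le (fun _ hμ => spectrum_le_of_mulVec_le (signlessLap_nonneg G) hx h hμ) hq

section Adjacency

variable {α β : Type*}

@[simp] theorem cone_adj_none_none (H : SimpleGraph α) : ¬ (cone H).Adj none none := by
  simp [cone]

@[simp] theorem cone_adj_none_some (H : SimpleGraph α) (a : α) :
    (cone H).Adj none (some a) := by
  simp [cone]

@[simp] theorem cone_adj_some_none (H : SimpleGraph α) (a : α) :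
    (cone H).Adj (some a) none := by
  simp [cone]

@[simp] theorem cone_adj_some_some (H : SimpleGraph α) (a b : α) :
    (cone H).Adj (some a) (some b) ↔ H.Adj a b := by
  simp only [cone, fromRel_adj]
  constructor
  · rintro ⟨-, h⟩
    simpa [H.adj_comm b a] using h
  · intro h
    simp [h, h.ne]

@[simp] theorem dUnion_adj_inl_inl (G : SimpleGraph α) (H : SimpleGraph β) (a b : α) :
    (dUnion G H).Adj (Sum.inl a) (Sum.inl b) ↔ G.Adj a b := by
  simp only [dUnion, fromRel_adj]
  constructor
  · rintro ⟨-, h⟩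
    simpa [G.adj_comm b a] using h
  · intro h
    simp [h, h.ne]

@[simp] theorem dUnion_adj_inr_inr (G : SimpleGraph α) (H : SimpleGraph β) (a b : β) :
    (dUnion G H).Adj (Sum.inr a) (Sum.inr b) ↔ H.Adj a b := by
  simp only [dUnion, fromRel_adj]
  constructor
  · rintro ⟨-, h⟩
    simpa [H.adj_comm b a] using h
  · intro h
    simp [h, h.ne]

@[simp] theorem dUnion_adj_inl_inr (G : SimpleGraph α) (H : SimpleGraph β) (a : α) (b : β) :
    ¬ (dUnion G H).Adj (Sum.inl a) (Sum.inr b) := by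
  simp [dUnion]

@[simp] theorem dUnion_adj_inr_inl (G : SimpleGraph α) (H : SimpleGraph β) (a : α) (b : β) :
    ¬ (dUnion G H).Adj (Sum.inr b) (Sum.inl a) := by
  simp [dUnion]

end Adjacency

theorem matching_adj {k : ℕ} (i i' : Fin k) (j j' : Fin 2) :
    (matching k).Adj (i, j) (i', j') ↔ i' = i ∧ j ≠ j' := by
  simp only [matching, fromRel_adj, ne_eq, Prod.mk.injEq]
  grind

theorem starGraph_adj {n : ℕ} (a b : Fin n) :
    (starGraph n).Adj a b ↔ a ≠ b ∧ ((a : ℕ) = 0 ∨ (b : ℕ) = 0) := by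
  simp [starGraph]

open scoped Classical in
theorem sum_matching_adj {k : ℕ} (a : Fin k × Fin 2) (s : ℝ) :
    (∑ b, if (matching k).Adj a b then s else 0) = s := by
  obtain ⟨i, j⟩ := a
  rw [Fintype.sum_prod_type]
  simp only [matching_adj, ite_and, Fin.sum_univ_two]
  fin_cases j <;> simp

/-- The defining equation of the `Q`-index of `K₁ ∨ kP₂`. -/
theorem exists_friendship_root {k : ℝ} (hk : 0 < k) :
    ∃ q : ℝ, 3 < q ∧ (q - 2 * k) * (q - 3) = 2 * k := by
  have hd : (0 : ℝ) ≤ (2 * k - 3) ^ 2 + 8 * k := by positivity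
  have hs := Real.sq_sqrt hd
  refine ⟨(2 * k + 3 + √((2 * k - 3) ^ 2 + 8 * k)) / 2, ?_, by nlinarith⟩
  have : 3 - 2 * k < √((2 * k - 3) ^ 2 + 8 * k) := Real.lt_sqrt_of_sq_lt (by nlinarith)
  linarith

theorem qIndex_cone_matching_le {k : ℕ} {q : ℝ} (hq : 3 < q)
    (h : (q - 2 * k) * (q - 3) = 2 * k) : qIndex (cone (matching k)) ≤ q := by
  classical
  refine qIndex_le _ (by linarith) (x := fun v => v.elim (q - 3) fun _ => 1) ?_ ?_
  · rintro (_ | a)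
    · simpa using hq
    · simp
  · rintro (_ | a)
    · rw [signlessLap_mulVec, Fintype.sum_option]
      simp
      nlinarith
    · rw [signlessLap_mulVec, Fintype.sum_option]
      simp only [Option.elim, cone_adj_some_none, cone_adj_some_some, sum_matching_adj, if_true]
      linarith

theorem lt_qIndex_cone_dUnion {m : ℕ} {q : ℝ} (hq : 3 < q)
    (h : (q - 2 * (m + 2)) * (q - 3) = 2 * (m + 2)) :
    q < qIndex (cone (dUnion (matching m) (dUnion (starGraph 3) (pathGraph 1)))) := by
  classical
  have hq0 : q ≠ 0 := by positivity
  obtain ⟨e, he⟩ : ∃ e : ℝ, e * q = 1 := ⟨q⁻¹, inv_mul_cancel₀ hq0⟩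
  have he0 : 0 < e := pos_of_mul_pos_left (he ▸ one_pos) (by linarith)
  refine lt_qIndex _ (fun v => v.elim (q - 3)
    (Sum.elim (fun _ => 1) (Sum.elim ![1 + e, 1, 1] fun _ => 1))) ?_
  simp only [dotProduct, signlessLap_mulVec, Fintype.sum_option, Fintype.sum_sum_type,
    Fin.sum_univ_three, Fin.sum_univ_one]
  simp [sum_matching_adj, starGraph_adj]
  linear_combination (q - 3) * h + e * he + 3 * he0 + 3 * mul_pos he0 he0

theorem stmt8 (k : ℕ) (hk : 2 ≤ k) :
    qIndex (cone (dUnion (matching (k - 2)) (dUnion (starGraph 3) (pathGraph 1)))) > qIndex (cone (matching k)) := by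
  obtain ⟨m, rfl⟩ := Nat.exists_eq_add_of_le' hk
  obtain ⟨q, hq, h⟩ := exists_friendship_root (k := ((m + 2 : ℕ) : ℝ)) (by positivity)
  rw [Nat.add_sub_cancel]
  exact (qIndex_cone_matching_le hq h).trans_lt (lt_qIndex_cone_dUnion hq (by push_cast at h; exact h))

end QPaper
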